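/- The sets D_π, as π ranges over all permutations of {1,…,n+1}, are nonempty, open, convex, and pairwise disjoint, and their union equals ℝ^n minus the union of the hyperplanes H_{i,j} = {x ∈ ℝ^n : x_i + x_{i+1} + ⋯ + x_{j−1} = 0} over all pairs 1 ≤ i < j ≤ n+1. -/

import Mathlib

open MeasureTheory

noncomputable section

/-- Walk positions: `walk n x i = x 0 + ⋯ + x (i-1)` (so `walk n x 0 = 0`). -/
def walk (n : ℕ) (x : Fin n → ℝ) (i : Fin (n + 1)) : ℝ :=
  ∑ j : Fin n, if (j : ℕ) < (i : ℕ) then x j else 0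

/-- The region of step tuples generating the ordinal pattern `π`. -/
def D (n : ℕ) (π : Equiv.Perm (Fin (n + 1))) : Set (Fin n → ℝ) :=
  {x | (∀ i j : Fin (n + 1), i ≠ j → walk n x i ≠ walk n x j) ∧
       (∀ i j : Fin (n + 1), walk n x i < walk n x j ↔ π i < π j)}

/-- The matrix `L_π`. -/
def L (n : ℕ) (π : Equiv.Perm (Fin (n + 1))) : Matrix (Fin n) (Fin n) ℝ :=
  fun i j =>
    if (π i.castSucc : ℕ) ≤ (j : ℕ) ∧ (j : ℕ) < (π i.succ : ℕ) then 1
    else if (π i.succ : ℕ) ≤ (j : ℕ) ∧ (j : ℕ) < (π i.castSucc : ℕ) then -1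
    else 0

/-- Partial sum `x i + x (i+1) + ⋯ + x (j-1)`. -/
def psum (n : ℕ) (x : Fin n → ℝ) (i j : Fin (n + 1)) : ℝ :=
  ∑ k : Fin n, if (i : ℕ) ≤ (k : ℕ) ∧ (k : ℕ) < (j : ℕ) then x k else 0

/-- The level count `lev(π)_j`. -/
def lev (n : ℕ) (π : Equiv.Perm (Fin (n + 1))) (j : Fin n) : ℕ :=
  (Finset.univ.filter fun i : Fin n =>
    ((π i.castSucc : ℕ) ≤ (j : ℕ) ∧ (j : ℕ) < (π i.succ : ℕ)) ∨
    ((π i.succ : ℕ) ≤ (j : ℕ) ∧ (j : ℕ) < (π i.castSucc : ℕ))).card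

/-- The polytope of steps `P_π`. -/
def Ppoly (n : ℕ) (π : Equiv.Perm (Fin (n + 1))) : Set (Fin n → ℝ) :=
  {x | (∀ i, 0 ≤ x i) ∧ ∀ i : Fin n,
    psum n x (min (π i.castSucc) (π i.succ)) (max (π i.castSucc) (π i.succ)) ≤ 1}

/-- The set of positive roots, identified with pairs `i < j`. -/
def PosRoot (n : ℕ) := {p : Fin (n + 1) × Fin (n + 1) // p.1 < p.2}

/-- The Shi condition for an alcove address. -/
def Shi (n : ℕ) (k : PosRoot n → ℤ) : Prop :=
  ∀ (i t j : Fin (n + 1)) (hit : i < t) (htj : t < j),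
    k ⟨(i, t), hit⟩ + k ⟨(t, j), htj⟩ ≤ k ⟨(i, j), hit.trans htj⟩ ∧
    k ⟨(i, j), hit.trans htj⟩ ≤ k ⟨(i, t), hit⟩ + k ⟨(t, j), htj⟩ + 1

/-- The alcove with address `k`, in step coordinates. -/
def alcove (n : ℕ) (k : PosRoot n → ℤ) : Set (Fin n → ℝ) :=
  {x | ∀ p : PosRoot n,
    (k p : ℝ) < psum n x p.1.1 p.1.2 ∧ psum n x p.1.1 p.1.2 < (k p : ℝ) + 1}

/-- The root ideal `I_π`. -/
def rootIdeal (n : ℕ) (π : Equiv.Perm (Fin (n + 1))) : Set (PosRoot n) :=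
  {p | ∃ c : Fin n,
    min (π c.castSucc : ℕ) (π c.succ : ℕ) ≤ (p.1.1 : ℕ) ∧
    (p.1.2 : ℕ) ≤ max (π c.castSucc : ℕ) (π c.succ : ℕ)}

/-- The level count matrix `lev(π)_{i,j}`. -/
def lev2 (n : ℕ) (π : Equiv.Perm (Fin (n + 1))) (i j : Fin n) : ℕ :=
  (Finset.univ.filter fun k : Fin n =>
    ((π k.castSucc : ℕ) ≤ (i : ℕ) ∧ (π k.castSucc : ℕ) ≤ (j : ℕ) ∧
     (i : ℕ) < (π k.succ : ℕ) ∧ (j : ℕ) < (π k.succ : ℕ)) ∨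
    ((π k.succ : ℕ) ≤ (i : ℕ) ∧ (π k.succ : ℕ) ≤ (j : ℕ) ∧
     (i : ℕ) < (π k.castSucc : ℕ) ∧ (j : ℕ) < (π k.castSucc : ℕ))).card

theorem walk_zero (n : ℕ) (x : Fin n → ℝ) : walk n x 0 = 0 := by
  simp [walk]

theorem walk_succ (n : ℕ) (x : Fin n → ℝ) (k : Fin n) :
    walk n x k.succ = walk n x k.castSucc + x k := by
  have hx : x k = ∑ j : Fin n, if j = k then x j else 0 := by simp
  rw [hx]
  unfold walk
  rw [← Finset.sum_add_distrib]
  refine Finset.sum_congr rfl fun j _ => ?_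
  simp only [Fin.val_succ, Fin.val_castSucc, Fin.ext_iff]
  split_ifs <;> first | omega | simp

theorem psum_eq_walk_sub (n : ℕ) (x : Fin n → ℝ) {i j : Fin (n + 1)} (h : i ≤ j) :
    psum n x i j = walk n x j - walk n x i := by
  have h' : (i : ℕ) ≤ j := h
  unfold psum walk
  rw [← Finset.sum_sub_distrib]
  refine Finset.sum_congr rfl fun k _ => ?_
  split_ifs <;> first | omega | simp

theorem walk_combo (n : ℕ) (a b : ℝ) (x y : Fin n → ℝ) (i : Fin (n + 1)) :
    walk n (a • x + b • y) i = a * walk n x i + b * walk n y i := by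
  unfold walk
  rw [Finset.mul_sum, Finset.mul_sum, ← Finset.sum_add_distrib]
  refine Finset.sum_congr rfl fun k _ => ?_
  split_ifs <;> simp

theorem continuous_walk (n : ℕ) (i : Fin (n + 1)) : Continuous fun x => walk n x i := by
  unfold walk
  refine continuous_finsetSum _ fun k _ => ?_
  split_ifs <;> fun_prop

theorem mem_D_iff (n : ℕ) (π : Equiv.Perm (Fin (n + 1))) (x : Fin n → ℝ) :
    x ∈ D n π ↔ ∀ i j, π i < π j → walk n x i < walk n x j := by
  refine ⟨fun h i j => (h.2 i j).2, fun h => ⟨fun i j hij => ?_, fun i j => ⟨fun hw => ?_, h i j⟩⟩⟩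
  · rcases lt_or_gt_of_ne (π.injective.ne hij) with hlt | hlt
    · exact (h i j hlt).ne
    · exact (h j i hlt).ne'
  · by_contra hle
    rcases (not_lt.1 hle).lt_or_eq with hlt | heq
    · exact lt_asymm hw (h j i hlt)
    · exact hw.ne (by rw [π.injective heq])

theorem nonempty_D (n : ℕ) (π : Equiv.Perm (Fin (n + 1))) : (D n π).Nonempty := by
  refine ⟨fun k => ((π k.succ : ℕ) : ℝ) - ((π k.castSucc : ℕ) : ℝ), ?_⟩
  rw [mem_D_iff]
  set x : Fin n → ℝ := fun k => ((π k.succ : ℕ) : ℝ) - ((π k.castSucc : ℕ) : ℝ) with hx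
  have key : ∀ i, walk n x i = ((π i : ℕ) : ℝ) - ((π 0 : ℕ) : ℝ) := by
    intro i
    induction i using Fin.induction with
    | zero => simp [walk_zero]
    | succ k ih => rw [walk_succ, ih, hx]; ring
  intro i j hij
  rw [key, key]
  have : ((π i : ℕ) : ℝ) < ((π j : ℕ) : ℝ) := by exact_mod_cast hij
  linarith

theorem isOpen_D (n : ℕ) (π : Equiv.Perm (Fin (n + 1))) : IsOpen (D n π) := by
  have h : D n π = ⋂ i, ⋂ j, ⋂ _ : π i < π j, {x | walk n x i < walk n x j} := by
    ext x
    simp [mem_D_iff]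
  rw [h]
  exact isOpen_iInter_of_finite fun i => isOpen_iInter_of_finite fun j =>
    isOpen_iInter_of_finite fun _ => isOpen_lt (continuous_walk n i) (continuous_walk n j)

theorem convex_D (n : ℕ) (π : Equiv.Perm (Fin (n + 1))) : Convex ℝ (D n π) := by
  intro x hx y hy a b ha hb hab
  rw [mem_D_iff] at hx hy ⊢
  intro i j hij
  rw [walk_combo, walk_combo]
  have hpos := convex_Ioi (0 : ℝ) (sub_pos.2 (hx i j hij)) (sub_pos.2 (hy i j hij)) ha hb hab
  simp only [smul_eq_mul, Set.mem_Ioi] at hpos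
  linarith

theorem disjoint_D (n : ℕ) {π τ : Equiv.Perm (Fin (n + 1))} (h : π ≠ τ) :
    Disjoint (D n π) (D n τ) := by
  rw [Set.disjoint_left]
  intro x hπ hτ
  have hmono : StrictMono (π.symm.trans τ) := fun a b hab => by
    refine (hτ.2 _ _).1 ((hπ.2 _ _).2 ?_)
    simpa using hab
  have hid := Subsingleton.elim
    (hmono.orderIsoOfSurjective _ (π.symm.trans τ).surjective) (OrderIso.refl _)
  apply h
  ext1 i
  simpa using (DFunLike.congr_fun hid (π i)).symm

theorem exists_mem_D_iff (n : ℕ) (x : Fin n → ℝ) :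
    (∃ π, x ∈ D n π) ↔ Function.Injective (walk n x) := by
  constructor
  · rintro ⟨π, h⟩ i j hij
    by_contra hne
    exact h.1 i j hne hij
  · intro hinj
    refine ⟨(Tuple.sort (walk n x)).symm, (mem_D_iff _ _ _).2 fun i j hij => ?_⟩
    have hle := Tuple.monotone_sort (walk n x) hij.le
    simp only [Function.comp_apply, Equiv.apply_symm_apply] at hle
    exact hle.lt_of_ne fun he => hij.ne (by rw [hinj he])

theorem injective_walk_iff (n : ℕ) (x : Fin n → ℝ) :
    Function.Injective (walk n x) ↔ ∀ p : PosRoot n, psum n x p.1.1 p.1.2 ≠ 0 := by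
  constructor
  · rintro h ⟨⟨i, j⟩, hij⟩ h0
    rw [psum_eq_walk_sub n x (le_of_lt hij), sub_eq_zero] at h0
    exact (ne_of_lt hij) (h h0).symm
  · intro h
    have hne : ∀ i j, i < j → walk n x i ≠ walk n x j := fun i j hij he =>
      h ⟨(i, j), hij⟩ (by rw [psum_eq_walk_sub n x hij.le, he, sub_self])
    intro i j he
    by_contra hij
    rcases lt_or_gt_of_ne hij with hlt | hlt
    · exact hne i j hlt he
    · exact hne j i hlt he.symm

/-- the regions `D_π` are nonempty, open, convex, pairwise disjoint,
and their union is the complement of the union of the hyperplanes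
`{x : x_i + ⋯ + x_{j-1} = 0}` over pairs `i < j`. -/
theorem stmt_3 (n : ℕ) (hn : 1 ≤ n) :
    (∀ π : Equiv.Perm (Fin (n + 1)),
      (D n π).Nonempty ∧ IsOpen (D n π) ∧ Convex ℝ (D n π)) ∧
    (∀ π τ : Equiv.Perm (Fin (n + 1)), π ≠ τ → Disjoint (D n π) (D n τ)) ∧
    (⋃ π : Equiv.Perm (Fin (n + 1)), D n π) =
      (⋃ p : PosRoot n, {x : Fin n → ℝ | psum n x p.1.1 p.1.2 = 0})ᶜ := by
  refine ⟨fun π => ⟨nonempty_D n π, isOpen_D n π, convex_D n π⟩, fun π τ h => disjoint_D n h, ?_⟩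
  ext x
  simp only [Set.mem_iUnion, exists_mem_D_iff, injective_walk_iff, Set.mem_compl_iff,
    Set.mem_ofPred_eq, not_exists, ne_eq]
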